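/- Let 𝒜 be a hyperplane arrangement in ℝⁿ and D a bounded chamber (its closure is compact). Then for every chamber C ≠ D, ∑_{F ≼ D} (−1)^{rk F} [FC = D] = 0, and for C = D this sum equals (−1)^{c_𝒜}; equivalently ∑_{F ≼ D} (−1)^{rk F} ∑_{C : FC = D} x_C = (−1)^{c_𝒜} x_D for any assignment x_C of values to chambers. -/

import Mathlib

attribute [local instance] Classical.propDecidable

noncomputable section

namespace Varchenko

/-- Sign of the point `x` with respect to the hyperplane `⟨a i, x⟩ = b i`. -/
def hsign {n : ℕ} {ι : Type*} (a : ι → Fin n → ℝ) (b : ι → ℝ) (i : ι)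
    (x : Fin n → ℝ) : SignType :=
  SignType.sign (∑ j, a i j * x j - b i)

/-- The set of points realizing the sign vector `σ`. -/
def cell {n : ℕ} {ι : Type*} (a : ι → Fin n → ℝ) (b : ι → ℝ)
    (σ : ι → SignType) : Set (Fin n → ℝ) :=
  {x | ∀ i, hsign a b i x = σ i}

/-- A face is a sign vector with nonempty realization. -/
def IsFace {n : ℕ} {ι : Type*} (a : ι → Fin n → ℝ) (b : ι → ℝ)
    (σ : ι → SignType) : Prop :=
  (cell a b σ).Nonempty

/-- A chamber is a face all of whose signs are nonzero. -/
def IsChamber {n : ℕ} {ι : Type*} (a : ι → Fin n → ℝ) (b : ι → ℝ)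
    (σ : ι → SignType) : Prop :=
  IsFace a b σ ∧ ∀ i, σ i ≠ 0

/-- The Tits product of two sign vectors. -/
def tits {ι : Type*} (σ τ : ι → SignType) : ι → SignType :=
  fun i => if σ i ≠ 0 then σ i else τ i

/-- The face partial order on sign vectors. -/
def faceLE {ι : Type*} (σ τ : ι → SignType) : Prop :=
  ∀ i, σ i ≠ 0 → σ i = τ i

/-- The Aguiar–Mahajan distance function, valued in `ℤ[h_H^± : H ∈ 𝒜]`,
where the variable `h_H^ε` is `X (H, ε)`. -/
def vdist {ι : Type*} [Fintype ι] (C D : ι → SignType) :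
    MvPolynomial (ι × SignType) ℤ :=
  ∏ i ∈ Finset.univ.filter (fun i => C i = -D i), MvPolynomial.X (i, C i)

/-- The set of half-spaces containing `C` but not `D`. -/
def Hset {ι : Type*} [Fintype ι] (C D : ι → SignType) : Finset (ι × SignType) :=
  (Finset.univ.filter (fun i => C i = -D i)).image (fun i => (i, C i))

/-- The weight `b_F = ∏_{H ∈ 𝒜_F} h_H⁺ h_H⁻` of a face. -/
def weight {ι : Type*} [Fintype ι] (σ : ι → SignType) :
    MvPolynomial (ι × SignType) ℤ :=
  ∏ i ∈ Finset.univ.filter (fun i => σ i = 0),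
    (MvPolynomial.X (i, 1) * MvPolynomial.X (i, -1))

/-- The dimension of a face. -/
def fdim {n : ℕ} {ι : Type*} (a : ι → Fin n → ℝ) (b : ι → ℝ)
    (σ : ι → SignType) : ℕ :=
  Module.finrank ℝ (affineSpan ℝ (cell a b σ)).direction

/-- The minimal dimension `c_𝒜` of a face of the arrangement. -/
def minDim {n : ℕ} {ι : Type*} (a : ι → Fin n → ℝ) (b : ι → ℝ) : ℕ :=
  sInf {d : ℕ | ∃ σ, IsFace a b σ ∧ fdim a b σ = d}

/-- The hyperplane with index `i`, as a set. -/
def hplane {n : ℕ} {ι : Type*} (a : ι → Fin n → ℝ) (b : ι → ℝ) (i : ι) :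
    Set (Fin n → ℝ) :=
  {x | hsign a b i x = 0}

/-- The multiplicity `β_F^H` of a face `F`, computed using `H ∈ 𝒜_F`. -/
def betaH {n : ℕ} {ι : Type*} [Fintype ι] (a : ι → Fin n → ℝ) (b : ι → ℝ)
    (i : ι) (σ : ι → SignType) : ℕ :=
  (Finset.univ.filter (fun C : ι → SignType => IsChamber a b C ∧
    closure (cell a b C) ∩ hplane a b i = cell a b σ)).card / 2

end Varchenko

namespace Varchenko

open Filter Topology

/-- `e` is the Euler characteristic with compact support of the interval `I`,
which is bounded and either open or closed. -/
def IsEulerInterval (I : Set ℝ) (e : ℤ) : Prop :=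
  (∃ u v, u < v ∧ I = Set.Ioo u v ∧ e = -1) ∨ (∃ u v, u ≤ v ∧ I = Set.Icc u v ∧ e = 1)

/-- `e` is the Euler characteristic with compact support of the nonempty convex set `K`, which is
either compact, or bounded and open in a translate of a linear subspace. -/
def IsEulerSet {n : ℕ} (K : Set (Fin n → ℝ)) (e : ℤ) : Prop :=
  K.Nonempty ∧ Convex ℝ K ∧ ((IsCompact K ∧ e = 1) ∨
    (Bornology.IsBounded K ∧ ∃ (W : Submodule ℝ (Fin n → ℝ)) (U : Set (Fin n → ℝ)), IsOpen U ∧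
      (∀ p ∈ K, ∀ x, x ∈ K ↔ x ∈ U ∧ x - p ∈ W) ∧ e = (-1) ^ Module.finrank ℝ W))

theorem IsEulerInterval.exists_jump {I : Set ℝ} {e : ℤ} (h : IsEulerInterval I e) :
    ∃ p : ℝ, ∀ x : ℝ, ∀ᶠ ε in 𝓝[>] (0 : ℝ),
      ((if x ∈ I then 1 else 0) - (if x + ε ∈ I then 1 else 0) : ℤ) = if x = p then e else 0 := by
  have small : ∀ δ : ℝ, 0 < δ → ∀ᶠ ε in 𝓝[>] (0 : ℝ), 0 < ε ∧ ε < δ := fun δ hδ =>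
    Ioo_mem_nhdsGT hδ
  have pos : ∀ y : ℝ, ∀ᶠ ε in 𝓝[>] (0 : ℝ), 0 < ε ∧ (0 < y → ε < y) := by
    intro y
    by_cases hy : 0 < y
    · filter_upwards [small y hy] with ε h using ⟨h.1, fun _ => h.2⟩
    · filter_upwards [small 1 one_pos] with ε h using ⟨h.1, fun h' => absurd h' hy⟩
  rcases h with ⟨u, v, huv, rfl, rfl⟩ | ⟨u, v, huv, rfl, rfl⟩
  · refine ⟨u, fun x => ?_⟩
    filter_upwards [pos (u - x), pos (v - x)] with ε h1 h2
    simp only [Set.mem_Ioo]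
    grind
  · refine ⟨v, fun x => ?_⟩
    filter_upwards [pos (u - x), pos (v - x)] with ε h1 h2
    simp only [Set.mem_Icc]
    grind

theorem sum_mul_eq_zero_of_isEulerInterval {κ : Type*} (s : Finset κ) (I : κ → Set ℝ)
    (e c : κ → ℤ) (hI : ∀ k ∈ s, IsEulerInterval (I k) (e k))
    (h : ∀ t, ∑ k ∈ s, (if t ∈ I k then c k else 0) = 0) : ∑ k ∈ s, c k * e k = 0 := by
  have hp : ∀ k, ∃ p : ℝ, k ∈ s → ∀ x : ℝ, ∀ᶠ ε in 𝓝[>] (0 : ℝ),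
      ((if x ∈ I k then 1 else 0) - (if x + ε ∈ I k then 1 else 0) : ℤ) =
        if x = p then e k else 0 := by
    intro k
    by_cases hk : k ∈ s
    · obtain ⟨p, hp⟩ := (hI k hk).exists_jump
      exact ⟨p, fun _ => hp⟩
    · exact ⟨0, fun h => absurd h hk⟩
  choose p hp using hp
  have ev : ∀ᶠ ε in 𝓝[>] (0 : ℝ), ∀ x ∈ s.image p, ∀ k ∈ s,
      ((if x ∈ I k then 1 else 0) - (if x + ε ∈ I k then 1 else 0) : ℤ) =
        if x = p k then e k else 0 := by
    rw [Filter.eventually_all_finset]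
    intro x _
    rw [Filter.eventually_all_finset]
    exact fun k hk => hp k hk x
  obtain ⟨ε, hε⟩ := ev.exists
  calc ∑ k ∈ s, c k * e k
      = ∑ k ∈ s, ∑ x ∈ s.image p, c k * (if x = p k then e k else 0) := by
        refine Finset.sum_congr rfl fun k hk => ?_
        rw [← Finset.mul_sum, Finset.sum_ite_eq', if_pos (Finset.mem_image_of_mem p hk)]
    _ = ∑ x ∈ s.image p, ∑ k ∈ s, ((if x ∈ I k then c k else 0) -
          (if x + ε ∈ I k then c k else 0)) := by
        rw [Finset.sum_comm]
        refine Finset.sum_congr rfl fun x hx => Finset.sum_congr rfl fun k hk => ?_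
        rw [← hε x hx k hk, mul_sub]
        simp
    _ = 0 := by simp [Finset.sum_sub_distrib, h]

/-- The slice of `K` at first coordinate `t`. -/
def slice {n : ℕ} (t : ℝ) (K : Set (Fin (n + 1) → ℝ)) : Set (Fin n → ℝ) :=
  {y | (Fin.cons t y : Fin (n + 1) → ℝ) ∈ K}

/-- The inclusion of the coordinate hyperplane where the first coordinate vanishes. -/
def consZero (n : ℕ) : (Fin n → ℝ) →ₗ[ℝ] (Fin (n + 1) → ℝ) where
  toFun y := Fin.cons 0 y
  map_add' x y := by ext i; refine Fin.cases ?_ (fun i => ?_) i <;> simp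
  map_smul' r x := by ext i; refine Fin.cases ?_ (fun i => ?_) i <;> simp

theorem consZero_injective (n : ℕ) : Function.Injective (consZero n) := fun _ _ h =>
  Fin.cons_right_injective (α := fun _ => ℝ) 0 h

theorem finrank_comap_consZero {n : ℕ} (W : Submodule ℝ (Fin (n + 1) → ℝ)) :
    Module.finrank ℝ (W.comap (consZero n)) =
      Module.finrank ℝ (LinearMap.ker ((LinearMap.proj (R := ℝ) (φ := fun _ => ℝ)
        (0 : Fin (n + 1))).domRestrict W)) := by
  have h : (W.comap (consZero n)).map (consZero n) = (LinearMap.ker ((LinearMap.proj (R := ℝ)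
      (φ := fun _ => ℝ) (0 : Fin (n + 1))).domRestrict W)).map W.subtype := by
    ext x
    simp only [Submodule.mem_map, Submodule.mem_comap, LinearMap.mem_ker]
    constructor
    · rintro ⟨y, hy, rfl⟩
      exact ⟨⟨_, hy⟩, rfl, rfl⟩
    · rintro ⟨⟨w, hw⟩, h0, rfl⟩
      have hw0 : consZero n (Fin.tail w) = w := by
        conv_rhs => rw [← Fin.cons_self_tail w]
        exact congrArg (fun r : ℝ => (Fin.cons r (Fin.tail w) : Fin (n + 1) → ℝ)) h0.symm
      exact ⟨Fin.tail w, hw0.symm ▸ hw, hw0⟩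
  rw [(Submodule.equivMapOfInjective _ (consZero_injective n) _).finrank_eq, h,
    Submodule.finrank_map_subtype_eq W]

theorem finrank_comap_consZero_eq {n : ℕ} (W : Submodule ℝ (Fin (n + 1) → ℝ))
    (h : ∀ w ∈ W, w 0 = 0) :
    Module.finrank ℝ (W.comap (consZero n)) = Module.finrank ℝ W := by
  rw [finrank_comap_consZero, LinearMap.ker_eq_top.2, finrank_top]
  ext w
  exact h w w.2

theorem finrank_comap_consZero_add_one {n : ℕ} (W : Submodule ℝ (Fin (n + 1) → ℝ))
    (h : ∃ w ∈ W, w 0 ≠ 0) :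
    Module.finrank ℝ (W.comap (consZero n)) + 1 = Module.finrank ℝ W := by
  obtain ⟨w, hw, hw0⟩ := h
  rw [finrank_comap_consZero, ← LinearMap.finrank_range_add_finrank_ker
    ((LinearMap.proj (R := ℝ) (φ := fun _ => ℝ) (0 : Fin (n + 1))).domRestrict W),
    LinearMap.range_eq_top.2, finrank_top, Module.finrank_self, add_comm]
  exact LinearMap.surjective fun h => hw0 (LinearMap.congr_fun h ⟨w, hw⟩)

theorem slice_eq_empty {n : ℕ} {K : Set (Fin (n + 1) → ℝ)} {t : ℝ}
    (ht : t ∉ (fun x : Fin (n + 1) → ℝ => x 0) '' K) : slice t K = ∅ := by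
  ext y
  exact iff_of_false (fun hy => ht ⟨_, hy, rfl⟩) id

theorem slice_nonempty {n : ℕ} {K : Set (Fin (n + 1) → ℝ)} {t : ℝ}
    (ht : t ∈ (fun x : Fin (n + 1) → ℝ => x 0) '' K) : (slice t K).Nonempty := by
  obtain ⟨x, hx, rfl⟩ := ht
  exact ⟨Fin.tail x, by simpa [slice] using hx⟩

theorem slice_eq_image {n : ℕ} (K : Set (Fin (n + 1) → ℝ)) (t : ℝ) :
    slice t K = Fin.tail '' (K ∩ {x | x 0 = t}) := by
  ext y
  constructor
  · exact fun hy => ⟨Fin.cons t y, ⟨hy, rfl⟩, rfl⟩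
  · rintro ⟨x, ⟨hx, rfl⟩, rfl⟩
    simpa [slice] using hx

theorem cons_sub_cons {n : ℕ} (t : ℝ) (x y : Fin n → ℝ) :
    (Fin.cons t x - Fin.cons t y : Fin (n + 1) → ℝ) = consZero n (x - y) := by
  ext i
  refine Fin.cases ?_ (fun i => ?_) i <;> simp [consZero]

theorem convex_slice {n : ℕ} {K : Set (Fin (n + 1) → ℝ)} (hK : Convex ℝ K) (t : ℝ) :
    Convex ℝ (slice t K) := by
  intro x hx y hy u v hu hv huv
  have := hK hx hy hu hv huv
  have h : (Fin.cons t (u • x + v • y) : Fin (n + 1) → ℝ) =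
      u • (Fin.cons t x : Fin (n + 1) → ℝ) + v • (Fin.cons t y : Fin (n + 1) → ℝ) := by
    ext i
    refine Fin.cases ?_ (fun i => ?_) i
    · simp [← add_mul, huv]
    · simp
  rwa [← h] at this

theorem continuous_tail (n : ℕ) :
    Continuous (Fin.tail : (Fin (n + 1) → ℝ) → (Fin n → ℝ)) :=
  continuous_pi fun i => continuous_apply i.succ

theorem isCompact_slice {n : ℕ} {K : Set (Fin (n + 1) → ℝ)} (hK : IsCompact K) (t : ℝ) :
    IsCompact (slice t K) := by
  rw [slice_eq_image]
  exact (hK.inter_right (isClosed_eq (continuous_apply 0) continuous_const)).image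
    (continuous_tail n)

theorem isBounded_slice {n : ℕ} {K : Set (Fin (n + 1) → ℝ)} (hK : Bornology.IsBounded K) (t : ℝ) :
    Bornology.IsBounded (slice t K) :=
  (isCompact_slice hK.isCompact_closure t).isBounded.subset fun _ hy => subset_closure hy

theorem isOpen_slice {n : ℕ} {K : Set (Fin (n + 1) → ℝ)} (hK : IsOpen K) (t : ℝ) :
    IsOpen (slice t K) :=
  hK.preimage (by fun_prop)

theorem eq_Ioo_of_isOpen {I : Set ℝ} (hne : I.Nonempty) (hc : Convex ℝ I) (ho : IsOpen I)
    (hb : Bornology.IsBounded I) : ∃ u v, u < v ∧ I = Set.Ioo u v := by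
  have hI : I = Set.Ioo (sInf I) (sSup I) := by
    refine Set.Subset.antisymm (fun x hx => ?_)
      (IsConnected.Ioo_csInf_csSup_subset ⟨hne, hc.isPreconnected⟩ hb.bddBelow hb.bddAbove)
    obtain ⟨l, r, hlr, hs⟩ := (mem_nhds_iff_exists_Ioo_subset).1 (ho.mem_nhds hx)
    obtain ⟨y, hy⟩ := exists_between hlr.1
    obtain ⟨z, hz⟩ := exists_between hlr.2
    exact ⟨(csInf_le hb.bddBelow (hs ⟨hy.1, hy.2.trans hlr.2⟩)).trans_lt hy.2,
      hz.1.trans_le (le_csSup hb.bddAbove (hs ⟨hlr.1.trans hz.1, hz.2⟩))⟩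
  refine ⟨_, _, ?_, hI⟩
  obtain ⟨x, hx⟩ := hne
  rw [hI] at hx
  exact hx.1.trans hx.2

theorem IsEulerSet.exists_slices {n : ℕ} {K : Set (Fin (n + 1) → ℝ)} {e : ℤ}
    (h : IsEulerSet K e) : ∃ (I : Set ℝ) (e₁ e₂ : ℤ), IsEulerInterval I e₁ ∧ e = e₁ * e₂ ∧
      (∀ t ∉ I, slice t K = ∅) ∧ ∀ t ∈ I, IsEulerSet (slice t K) e₂ := by
  obtain ⟨hne, hc, h⟩ := h
  have hI : Convex ℝ ((fun x : Fin (n + 1) → ℝ => x 0) '' K) :=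
    hc.linear_image (LinearMap.proj (R := ℝ) (φ := fun _ => ℝ) (0 : Fin (n + 1)))
  rcases h with ⟨hK, rfl⟩ | ⟨hK, W, U, hU, hKU, rfl⟩
  · refine ⟨(fun x : Fin (n + 1) → ℝ => x 0) '' K, 1, 1, Or.inr ?_, rfl,
      fun t ht => slice_eq_empty ht, fun t ht => ⟨slice_nonempty ht, convex_slice hc t,
        Or.inl ⟨isCompact_slice hK t, rfl⟩⟩⟩
    have hKI := hK.image (continuous_apply (0 : Fin (n + 1)))
    have hIc := eq_Icc_of_connected_compact ⟨hne.image _, hI.isPreconnected⟩ hKI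
    refine ⟨_, _, ?_, hIc, rfl⟩
    exact Set.nonempty_Icc.1 (hIc ▸ hne.image _)
  · have hs : ∀ t ∈ (fun x : Fin (n + 1) → ℝ => x 0) '' K, IsEulerSet (slice t K)
        ((-1) ^ Module.finrank ℝ (W.comap (consZero n))) := by
      refine fun t ht => ⟨slice_nonempty ht, convex_slice hc t, Or.inr ⟨isBounded_slice hK t,
        W.comap (consZero n), slice t U, isOpen_slice hU t, fun p hp x => ?_, rfl⟩⟩
      rw [Submodule.mem_comap, ← cons_sub_cons t]
      exact hKU _ hp _
    by_cases hW : ∃ w ∈ W, w 0 ≠ 0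
    · refine ⟨(fun x : Fin (n + 1) → ℝ => x 0) '' K, -1, _, Or.inl ?_, ?_,
        fun t ht => slice_eq_empty ht, hs⟩
      · have hb : Bornology.IsBounded ((fun x : Fin (n + 1) → ℝ => x 0) '' K) :=
          ((hK.isCompact_closure.image (continuous_apply (0 : Fin (n + 1)))).isBounded).subset
            (Set.image_mono subset_closure)
        have ho : IsOpen ((fun x : Fin (n + 1) → ℝ => x 0) '' K) := by
          rw [isOpen_iff_mem_nhds]
          rintro _ ⟨p, hp, rfl⟩
          obtain ⟨w, hw, hw0⟩ := hW
          have hcont : Continuous fun t : ℝ => p + ((t - p 0) / w 0) • w := by fun_prop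
          have hmem : ∀ᶠ t in 𝓝 (p 0), p + ((t - p 0) / w 0) • w ∈ U :=
            hcont.continuousAt.eventually_mem (hU.mem_nhds (by simpa using ((hKU p hp p).1 hp).1))
          filter_upwards [hmem] with t ht
          refine ⟨_, (hKU p hp _).2 ⟨ht, ?_⟩, ?_⟩
          · simpa using W.smul_mem _ hw
          · simp [div_mul_cancel₀ _ hw0]
        obtain ⟨u, v, huv, h⟩ := eq_Ioo_of_isOpen (hne.image _) hI ho hb
        exact ⟨u, v, huv, h, rfl⟩
      · rw [← finrank_comap_consZero_add_one W hW, pow_succ']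
    · push Not at hW
      refine ⟨(fun x : Fin (n + 1) → ℝ => x 0) '' K, 1, _, Or.inr ?_, ?_,
        fun t ht => slice_eq_empty ht, hs⟩
      · obtain ⟨p, hp⟩ := hne
        refine ⟨p 0, p 0, le_rfl, ?_, rfl⟩
        rw [Set.Icc_self, Set.eq_singleton_iff_unique_mem]
        refine ⟨⟨p, hp, rfl⟩, ?_⟩
        rintro _ ⟨x, hx, rfl⟩
        exact sub_eq_zero.1 (hW _ ((hKU p hp x).1 hx).2)
      · rw [finrank_comap_consZero_eq W hW, one_mul]

theorem sum_mul_eq_zero_of_isEulerSet {n : ℕ} {κ : Type*} (s : Finset κ)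
    (K : κ → Set (Fin n → ℝ)) (e c : κ → ℤ) (hK : ∀ k ∈ s, IsEulerSet (K k) (e k))
    (h : ∀ x, ∑ k ∈ s, (if x ∈ K k then c k else 0) = 0) : ∑ k ∈ s, c k * e k = 0 := by
  induction n generalizing s e c with
  | zero =>
    rw [← h 0]
    refine Finset.sum_congr rfl fun k hk => ?_
    obtain ⟨⟨x, hx⟩, -, hk⟩ := hK k hk
    rw [if_pos (Subsingleton.elim x 0 ▸ hx)]
    rcases hk with ⟨-, h⟩ | ⟨-, W, U, -, -, h⟩
    · rw [h, mul_one]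
    · rw [h, Module.finrank_zero_of_subsingleton, pow_zero, mul_one]
  | succ n ih =>
    have hsl : ∀ k, ∃ (I : Set ℝ) (e₁ e₂ : ℤ), k ∈ s → IsEulerInterval I e₁ ∧ e k = e₁ * e₂ ∧
        (∀ t ∉ I, slice t (K k) = ∅) ∧ ∀ t ∈ I, IsEulerSet (slice t (K k)) e₂ := by
      intro k
      by_cases hk : k ∈ s
      · obtain ⟨I, e₁, e₂, h⟩ := (hK k hk).exists_slices
        exact ⟨I, e₁, e₂, fun _ => h⟩
      · exact ⟨∅, 0, 0, fun h => absurd h hk⟩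
    choose I e₁ e₂ hsl using hsl
    rw [← sum_mul_eq_zero_of_isEulerInterval s I e₁ (fun k => c k * e₂ k)
      (fun k hk => (hsl k hk).1) fun t => ?_]
    · refine Finset.sum_congr rfl fun k hk => ?_
      rw [(hsl k hk).2.1]
      ring
    · rw [← Finset.sum_filter]
      refine ih (s.filter fun k => t ∈ I k) (fun k => slice t (K k)) e₂ c (fun k hk => ?_)
        fun y => ?_
      · rw [Finset.mem_filter] at hk
        exact (hsl k hk.1).2.2.2 t hk.2
      · refine Eq.trans ?_ (h (Fin.cons t y))
        rw [Finset.sum_filter]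
        refine Finset.sum_congr rfl fun k hk => ?_
        by_cases ht : t ∈ I k
        · rw [if_pos ht]
          rfl
        · rw [if_neg ht, if_neg]
          exact fun hy => Set.notMem_empty y ((hsl k hk).2.2.1 t ht ▸ hy)

/-- The linear part of the equation of the hyperplane with index `i`. -/
def form {n : ℕ} {ι : Type*} (a : ι → Fin n → ℝ) (i : ι) : (Fin n → ℝ) →ₗ[ℝ] ℝ :=
  ∑ j, a i j • LinearMap.proj j

theorem hsign_eq {n : ℕ} {ι : Type*} (a : ι → Fin n → ℝ) (b : ι → ℝ) (i : ι) (x : Fin n → ℝ) :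
    hsign a b i x = SignType.sign (form a i x - b i) := by
  simp [hsign, form]

theorem continuous_form {n : ℕ} {ι : Type*} (a : ι → Fin n → ℝ) (i : ι) :
    Continuous (form a i) :=
  LinearMap.continuous_of_finiteDimensional _

theorem sign_eq_iff_pos {σ : SignType} (hσ : σ ≠ 0) (y : ℝ) :
    SignType.sign y = σ ↔ 0 < (σ : ℝ) * y := by
  cases σ with
  | zero => exact absurd rfl hσ
  | neg => simp [sign_eq_neg_one_iff]
  | pos => simp [sign_eq_one_iff]

theorem sign_eq_zero_or_eq_iff_nonneg {σ : SignType} (hσ : σ ≠ 0) (y : ℝ) :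
    (SignType.sign y = 0 ∨ SignType.sign y = σ) ↔ 0 ≤ (σ : ℝ) * y := by
  rw [sign_eq_iff_pos hσ, sign_eq_zero_iff, le_iff_lt_or_eq, or_comm, eq_comm (a := (0 : ℝ)),
    mul_eq_zero]
  cases σ <;> simp_all

/-- The linear subspace parallel to the face `σ`. -/
def faceDirection {n : ℕ} {ι : Type*} (a : ι → Fin n → ℝ) (σ : ι → SignType) :
    Submodule ℝ (Fin n → ℝ) :=
  ⨅ i, ⨅ (_ : σ i = 0), LinearMap.ker (form a i)

theorem mem_faceDirection {n : ℕ} {ι : Type*} {a : ι → Fin n → ℝ} {σ : ι → SignType}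
    {v : Fin n → ℝ} : v ∈ faceDirection a σ ↔ ∀ i, σ i = 0 → form a i v = 0 := by
  simp [faceDirection]

/-- The intersection of the open half-spaces containing the face `σ`. -/
def openStar {n : ℕ} {ι : Type*} (a : ι → Fin n → ℝ) (b : ι → ℝ) (σ : ι → SignType) :
    Set (Fin n → ℝ) :=
  {x | ∀ i, σ i ≠ 0 → hsign a b i x = σ i}

theorem isOpen_openStar {n : ℕ} {ι : Type*} [Finite ι] (a : ι → Fin n → ℝ) (b : ι → ℝ)
    (σ : ι → SignType) : IsOpen (openStar a b σ) := by
  simp only [openStar, Set.ofPred_forall]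
  refine isOpen_iInter_of_finite fun i => isOpen_iInter_of_finite fun hi => ?_
  simp only [hsign_eq, sign_eq_iff_pos hi]
  exact isOpen_lt continuous_const
    (continuous_const.mul ((continuous_form a i).sub continuous_const))

theorem mem_cell_iff {n : ℕ} {ι : Type*} {a : ι → Fin n → ℝ} {b : ι → ℝ} {σ : ι → SignType}
    {p : Fin n → ℝ} (hp : p ∈ cell a b σ) (x : Fin n → ℝ) :
    x ∈ cell a b σ ↔ x ∈ openStar a b σ ∧ x - p ∈ faceDirection a σ := by
  have key : ∀ i, σ i = 0 → (hsign a b i x = σ i ↔ form a i (x - p) = 0) := by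
    intro i hi
    have hpi := hp i
    rw [hi, hsign_eq, sign_eq_zero_iff, sub_eq_zero] at hpi ⊢
    rw [map_sub, hpi, sub_eq_zero]
  rw [mem_faceDirection]
  constructor
  · exact fun hx => ⟨fun i _ => hx i, fun i hi => (key i hi).1 (hx i)⟩
  · rintro ⟨h1, h2⟩ i
    by_cases hi : σ i = 0
    · exact (key i hi).2 (h2 i hi)
    · exact h1 i hi

theorem eventually_add_smul_mem_cell {n : ℕ} {ι : Type*} [Finite ι] {a : ι → Fin n → ℝ}
    {b : ι → ℝ} {σ : ι → SignType} {p v : Fin n → ℝ} (hp : p ∈ cell a b σ)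
    (hv : v ∈ faceDirection a σ) : ∀ᶠ ε in 𝓝 (0 : ℝ), p + ε • v ∈ cell a b σ := by
  have hcont : Continuous fun ε : ℝ => p + ε • v := by fun_prop
  have hmem : ∀ᶠ ε in 𝓝 (0 : ℝ), p + ε • v ∈ openStar a b σ :=
    hcont.continuousAt.eventually_mem ((isOpen_openStar a b σ).mem_nhds
      (by simpa using ((mem_cell_iff hp p).1 hp).1))
  filter_upwards [hmem] with ε h
  exact (mem_cell_iff hp _).2 ⟨h, by simpa using Submodule.smul_mem _ ε hv⟩

theorem direction_affineSpan_cell {n : ℕ} {ι : Type*} [Finite ι] {a : ι → Fin n → ℝ}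
    {b : ι → ℝ} {σ : ι → SignType} (hσ : IsFace a b σ) :
    (affineSpan ℝ (cell a b σ)).direction = faceDirection a σ := by
  rw [direction_affineSpan]
  refine le_antisymm ?_ fun v hv => ?_
  · rw [vectorSpan_def, Submodule.span_le]
    rintro _ ⟨x, hx, p, hp, rfl⟩
    exact ((mem_cell_iff hp x).1 hx).2
  · obtain ⟨p, hp⟩ := hσ
    obtain ⟨ε, hε, h0⟩ := ((eventually_add_smul_mem_cell hp hv).filter_mono
      nhdsWithin_le_nhds |>.and (self_mem_nhdsWithin (s := Set.Ioi (0 : ℝ)))).exists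
    have h := vsub_mem_vectorSpan ℝ hε hp
    rw [vsub_eq_sub, add_sub_cancel_left] at h
    exact (Submodule.smul_mem_iff _ (ne_of_gt h0)).1 h

theorem convex_cell {n : ℕ} {ι : Type*} (a : ι → Fin n → ℝ) (b : ι → ℝ) (σ : ι → SignType) :
    Convex ℝ (cell a b σ) := by
  simp only [cell, Set.ofPred_forall, hsign_eq]
  refine convex_iInter fun i => ?_
  cases h : σ i with
  | zero =>
    simpa [sign_eq_zero_iff, sub_eq_zero] using
      convex_hyperplane (form a i).isLinear (b i)
  | neg =>
    simpa [sign_eq_neg_one_iff] using convex_halfSpace_lt (form a i).isLinear (b i)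
  | pos =>
    simpa [sign_eq_one_iff] using convex_halfSpace_gt (form a i).isLinear (b i)

theorem isEulerSet_cell {n : ℕ} {ι : Type*} [Finite ι] {a : ι → Fin n → ℝ} {b : ι → ℝ}
    {σ : ι → SignType} (hσ : IsFace a b σ) (hb : Bornology.IsBounded (cell a b σ)) :
    IsEulerSet (cell a b σ) ((-1) ^ fdim a b σ) := by
  refine ⟨hσ, convex_cell a b σ, Or.inr ⟨hb, faceDirection a σ, openStar a b σ,
    isOpen_openStar a b σ, fun p hp x => mem_cell_iff hp x, ?_⟩⟩
  rw [fdim, direction_affineSpan_cell hσ]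

/-- The intersection of the closed half-spaces containing the chamber `D`. -/
def closedCell {n : ℕ} {ι : Type*} (a : ι → Fin n → ℝ) (b : ι → ℝ) (D : ι → SignType) :
    Set (Fin n → ℝ) :=
  {x | ∀ i, 0 ≤ (D i : ℝ) * (form a i x - b i)}

theorem closedCell_subset_closure {n : ℕ} {ι : Type*} {a : ι → Fin n → ℝ} {b : ι → ℝ}
    {D : ι → SignType} (hD : IsChamber a b D) : closedCell a b D ⊆ closure (cell a b D) := by
  intro x hx
  obtain ⟨⟨d, hd⟩, h0⟩ := hD
  have hsub : openSegment ℝ x d ⊆ cell a b D := by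
    rintro _ ⟨u, v, hu, hv, huv, rfl⟩ i
    have hdi := hd i
    rw [hsign_eq, sign_eq_iff_pos (h0 i)] at hdi ⊢
    have hE : (D i : ℝ) * (form a i (u • x + v • d) - b i) =
        u * ((D i : ℝ) * (form a i x - b i)) + v * ((D i : ℝ) * (form a i d - b i)) := by
      obtain rfl : u = 1 - v := by linarith
      simp only [map_add, map_smul, smul_eq_mul]
      ring
    rw [hE]
    exact add_pos_of_nonneg_of_pos (mul_nonneg hu.le (hx i)) (mul_pos hv hdi)
  refine closure_mono hsub ?_
  rw [closure_openSegment]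
  exact left_mem_segment ℝ x d

theorem isClosed_closedCell {n : ℕ} {ι : Type*} (a : ι → Fin n → ℝ) (b : ι → ℝ)
    (D : ι → SignType) : IsClosed (closedCell a b D) := by
  simp only [closedCell, Set.ofPred_forall]
  exact isClosed_iInter fun i => isClosed_le continuous_const
    (continuous_const.mul ((continuous_form a i).sub continuous_const))

theorem cell_subset_closedCell {n : ℕ} {ι : Type*} {a : ι → Fin n → ℝ} {b : ι → ℝ}
    {D F : ι → SignType} (hD : ∀ i, D i ≠ 0) (hF : faceLE F D) :
    cell a b F ⊆ closedCell a b D := by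
  intro x hx i
  rw [← sign_eq_zero_or_eq_iff_nonneg (hD i), ← hsign_eq, hx i]
  exact or_iff_not_imp_left.2 (hF i)

theorem minDim_eq_zero {n : ℕ} {ι : Type*} [Finite ι] {a : ι → Fin n → ℝ} {b : ι → ℝ}
    {D : ι → SignType} (hD : IsChamber a b D) (hbdd : IsCompact (closure (cell a b D))) :
    minDim a b = 0 := by
  have hcomp : IsCompact (closedCell a b D) :=
    hbdd.of_isClosed_subset (isClosed_closedCell a b D) (closedCell_subset_closure hD)
  obtain ⟨x, hx⟩ := hcomp.extremePoints_nonempty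
    (hD.1.mono (cell_subset_closedCell hD.2 fun _ _ => rfl))
  set F : ι → SignType := fun i => hsign a b i x with hF
  have hxF : x ∈ cell a b F := fun _ => rfl
  have hFD : faceLE F D := fun i hi => by
    have := (sign_eq_zero_or_eq_iff_nonneg (hD.2 i) _).2 (hx.1 i)
    rw [← hsign_eq] at this
    exact this.resolve_left hi
  have hbot : faceDirection a F = ⊥ := by
    rw [eq_bot_iff]
    intro v hv
    have h1 := eventually_add_smul_mem_cell hxF hv
    have h2 := eventually_add_smul_mem_cell hxF (Submodule.neg_mem _ hv)
    obtain ⟨ε, ⟨hε1, hε2⟩, h0⟩ := ((h1.and h2).filter_mono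
      nhdsWithin_le_nhds |>.and (self_mem_nhdsWithin (s := Set.Ioi (0 : ℝ)))).exists
    have hsub := cell_subset_closedCell (a := a) (b := b) hD.2 hFD
    have h := hx.2 (hsub hε1) (hsub hε2)
      ⟨1 / 2, 1 / 2, by norm_num, by norm_num, by norm_num, by module⟩
    have hv0 : ε • v = 0 := by simpa using h
    simpa [ne_of_gt h0] using hv0
  refine Nat.sInf_eq_zero.2 (Or.inl ⟨F, ⟨x, hxF⟩, ?_⟩)
  rw [fdim, direction_affineSpan_cell ⟨x, hxF⟩, hbot, finrank_bot]

/-- The part of a closed ball on the side of `D` of the hyperplanes outside `S`, and on the other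
side of the hyperplanes in `J`. -/
def farSide {n : ℕ} {ι : Type*} (a : ι → Fin n → ℝ) (b : ι → ℝ) (D : ι → SignType)
    (r : ℝ) (S J : Finset ι) : Set (Fin n → ℝ) :=
  Metric.closedBall 0 r ∩ ({x | ∀ i ∉ S, 0 ≤ (D i : ℝ) * (form a i x - b i)} ∩
    {x | ∀ i ∈ J, (D i : ℝ) * (form a i x - b i) ≤ 0})

theorem isEulerSet_farSide {n : ℕ} {ι : Type*} {a : ι → Fin n → ℝ} {b : ι → ℝ}
    {D : ι → SignType} {r : ℝ} {S J : Finset ι} (h : (farSide a b D r S J).Nonempty) :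
    IsEulerSet (farSide a b D r S J) 1 := by
  refine ⟨h, ?_, Or.inl ⟨?_, rfl⟩⟩
  · refine (convex_closedBall 0 r).inter (Convex.inter ?_ ?_)
    · simp only [Set.ofPred_forall]
      refine convex_iInter fun i => convex_iInter fun _ => ?_
      simpa [mul_sub] using
        convex_halfSpace_ge ((D i : ℝ) • form a i).isLinear ((D i : ℝ) * b i)
    · simp only [Set.ofPred_forall]
      refine convex_iInter fun i => convex_iInter fun _ => ?_
      simpa [mul_sub] using
        convex_halfSpace_le ((D i : ℝ) • form a i).isLinear ((D i : ℝ) * b i)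
  · refine (isCompact_closedBall 0 r).inter_right (IsClosed.inter ?_ ?_)
    · simp only [Set.ofPred_forall]
      exact isClosed_iInter fun i => isClosed_iInter fun _ => isClosed_le continuous_const
        (continuous_const.mul ((continuous_form a i).sub continuous_const))
    · simp only [Set.ofPred_forall]
      exact isClosed_iInter fun i => isClosed_iInter fun _ => isClosed_le
        (continuous_const.mul ((continuous_form a i).sub continuous_const)) continuous_const

theorem sum_farSide {n : ℕ} {ι : Type*} {a : ι → Fin n → ℝ} {b : ι → ℝ}
    {D : ι → SignType} {r : ℝ} {S : Finset ι} (x : Fin n → ℝ) :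
    ∑ J ∈ S.powerset, (if x ∈ farSide a b D r S J then (-1 : ℤ) ^ J.card else 0) =
      if x ∈ Metric.closedBall 0 r ∧ (∀ i ∉ S, 0 ≤ (D i : ℝ) * (form a i x - b i)) ∧
        ∀ i ∈ S, 0 < (D i : ℝ) * (form a i x - b i) then 1 else 0 := by
  rw [← Finset.sum_filter]
  by_cases hx : x ∈ Metric.closedBall 0 r ∧ ∀ i ∉ S, 0 ≤ (D i : ℝ) * (form a i x - b i)
  · have hfilter : S.powerset.filter (fun J => x ∈ farSide a b D r S J) =
        (S.filter fun i => (D i : ℝ) * (form a i x - b i) ≤ 0).powerset := by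
      ext J
      simp only [Finset.mem_filter, Finset.mem_powerset, Finset.subset_iff, farSide,
        Set.mem_inter_iff, Set.mem_ofPred_eq, hx.1, true_and]
      exact ⟨fun h i hi => ⟨h.1 hi, h.2.2 i hi⟩,
        fun h => ⟨fun i hi => (h hi).1, hx.2, fun i hi => (h hi).2⟩⟩
    rw [hfilter, Finset.sum_powerset_neg_one_pow_card]
    simp only [Finset.filter_eq_empty_iff, not_le]
    congr 1
    exact propext ⟨fun h => ⟨hx.1, hx.2, fun i hi => h hi⟩, fun h i hi => h.2.2 i hi⟩
  · rw [if_neg fun h => hx ⟨h.1, h.2.1⟩, Finset.filter_false_of_mem, Finset.sum_empty]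
    exact fun J _ h => hx ⟨h.1, h.2.1⟩

theorem sum_neg_one_pow_fdim {n : ℕ} {ι : Type*} [Fintype ι] {a : ι → Fin n → ℝ} {b : ι → ℝ}
    {C D : ι → SignType} (hC : IsChamber a b C) (hD : IsChamber a b D)
    (hbdd : IsCompact (closure (cell a b D))) :
    ∑ F ∈ Finset.univ.filter (fun F : ι → SignType =>
      IsFace a b F ∧ faceLE F D ∧ tits F C = D), (-1 : ℤ) ^ fdim a b F =
        if C = D then 1 else 0 := by
  set S : Finset ι := Finset.univ.filter fun i => C i ≠ D i with hS
  obtain ⟨q, hq⟩ := hC.1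
  have hb : Bornology.IsBounded (closedCell a b D) :=
    hbdd.isBounded.subset (closedCell_subset_closure hD)
  obtain ⟨r, hr⟩ := (hb.union (Bornology.isBounded_singleton (x := q))).subset_closedBall 0
  have hqS : ∀ J ∈ S.powerset, q ∈ farSide a b D r S J := by
    intro J hJ
    refine ⟨hr (Or.inr rfl), fun i hi => ?_, fun i hi => ?_⟩
    · have h : C i = D i := by simpa [hS] using hi
      rw [← sign_eq_zero_or_eq_iff_nonneg (hD.2 i), ← hsign_eq, hq i]
      exact Or.inr h
    · have h : C i ≠ D i := by simpa [hS] using Finset.mem_powerset.1 hJ hi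
      rw [← not_lt, ← sign_eq_iff_pos (hD.2 i), ← hsign_eq, hq i]
      exact h
  set T := Finset.univ.filter (fun F : ι → SignType =>
    IsFace a b F ∧ faceLE F D ∧ tits F C = D) with hT
  have hcells : ∀ x, ∑ F ∈ T, (if x ∈ cell a b F then (1 : ℤ) else 0) =
      if x ∈ Metric.closedBall 0 r ∧ (∀ i ∉ S, 0 ≤ (D i : ℝ) * (form a i x - b i)) ∧
        ∀ i ∈ S, 0 < (D i : ℝ) * (form a i x - b i) then 1 else 0 := by
    intro x
    have hx : ∀ F : ι → SignType, x ∈ cell a b F ↔ F = fun i => hsign a b i x := fun F =>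
      ⟨fun h => funext fun i => (h i).symm, fun h i => (congrFun h i).symm⟩
    simp only [hx, Finset.sum_ite_eq']
    congr 1
    have hface : IsFace a b fun i => hsign a b i x := ⟨x, fun _ => rfl⟩
    simp only [hT, Finset.mem_filter, Finset.mem_univ, true_and, hface, hS, not_not]
    simp only [← sign_eq_zero_or_eq_iff_nonneg (hD.2 _), ← sign_eq_iff_pos (hD.2 _), ← hsign_eq]
    refine propext ⟨fun ⟨h1, h2⟩ => ⟨?_, ?_, ?_⟩, fun ⟨_, h1, h2⟩ => ⟨?_, ?_⟩⟩
    · exact hr (Or.inl (cell_subset_closedCell hD.2 h1 ((hx _).2 rfl)))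
    · exact fun i _ => or_iff_not_imp_left.2 (h1 i)
    · intro i hi
      by_cases h0 : hsign a b i x = 0
      · exact absurd (by simpa [tits, h0] using congrFun h2 i) hi
      · exact h1 i h0
    · intro i h0
      by_cases hi : C i = D i
      · exact (h1 i hi).resolve_left h0
      · exact h2 i hi
    · ext1 i
      by_cases hi : C i = D i
      · rcases h1 i hi with h | h
        · simp [tits, h, hi]
        · simp [tits, h, hD.2 i]
      · simp [tits, h2 i hi, hD.2 i]
  have key := sum_mul_eq_zero_of_isEulerSet (T.disjSum S.powerset)
    (Sum.elim (cell a b) (farSide a b D r S))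
    (Sum.elim (fun F => (-1) ^ fdim a b F) fun _ => 1)
    (Sum.elim (fun _ => 1) fun J => -(-1) ^ J.card) ?_ ?_
  · simp only [Finset.sum_disjSum, Sum.elim_inl, Sum.elim_inr, one_mul, mul_one,
      Finset.sum_neg_distrib, Finset.sum_powerset_neg_one_pow_card] at key
    rw [← sub_eq_add_neg, sub_eq_zero] at key
    rw [key]
    congr 1
    simp [hS, Finset.filter_eq_empty_iff, funext_iff]
  · intro k hk
    rcases Finset.mem_disjSum.1 hk with ⟨F, hF, rfl⟩ | ⟨J, hJ, rfl⟩
    · have hF' := (Finset.mem_filter.1 hF).2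
      exact isEulerSet_cell hF'.1 (hb.subset (cell_subset_closedCell hD.2 hF'.2.1))
    · exact isEulerSet_farSide ⟨q, hqS J hJ⟩
  · intro x
    have hneg : ∀ J : Finset ι, (if x ∈ farSide a b D r S J then -(-1 : ℤ) ^ J.card else 0) =
        -(if x ∈ farSide a b D r S J then (-1 : ℤ) ^ J.card else 0) := by
      intro J
      split_ifs <;> simp
    rw [Finset.sum_disjSum]
    refine Eq.trans (congrArg₂ (· + ·) (hcells x) (Finset.sum_congr rfl fun J _ => hneg J)) ?_
    rw [Finset.sum_neg_distrib, sum_farSide]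
    split_ifs <;> simp

theorem bounded_chamber_witt {n : ℕ} {ι : Type*} [Fintype ι]
    {R : Type*} [CommRing R]
    (a : ι → Fin n → ℝ) (b : ι → ℝ) (ha : ∀ i, a i ≠ 0)
    (D : ι → SignType) (hD : IsChamber a b D)
    (hbdd : IsCompact (closure (cell a b D))) (x : (ι → SignType) → R) :
    (∀ C : ι → SignType, IsChamber a b C → C ≠ D →
      ∑ F ∈ Finset.univ.filter (fun F : ι → SignType =>
          IsFace a b F ∧ faceLE F D ∧ tits F C = D),
        ((-1 : ℤ) ^ (fdim a b F - minDim a b)) = 0) ∧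
    (∑ F ∈ Finset.univ.filter (fun F : ι → SignType =>
        IsFace a b F ∧ faceLE F D ∧ tits F D = D),
      ((-1 : ℤ) ^ (fdim a b F - minDim a b)) = (-1 : ℤ) ^ minDim a b) ∧
    (∑ F ∈ Finset.univ.filter (fun F : ι → SignType =>
        IsFace a b F ∧ faceLE F D),
      ((-1 : R) ^ (fdim a b F - minDim a b)) *
        ∑ C ∈ Finset.univ.filter (fun C : ι → SignType =>
            IsChamber a b C ∧ tits F C = D), x C =
      ((-1 : R) ^ minDim a b) * x D) := by
  have h0 : minDim a b = 0 := minDim_eq_zero hD hbdd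
  simp only [h0, Nat.sub_zero, pow_zero, one_mul]
  refine ⟨fun C hC hCD => (sum_neg_one_pow_fdim hC hD hbdd).trans (if_neg hCD),
    (sum_neg_one_pow_fdim hD hD hbdd).trans (if_pos rfl), ?_⟩
  simp only [Finset.sum_filter, Finset.mul_sum]
  have hswap : ∀ C, IsChamber a b C → ∑ F : ι → SignType,
      (if IsFace a b F ∧ faceLE F D ∧ tits F C = D then (-1 : R) ^ fdim a b F else 0) =
        if C = D then 1 else 0 := by
    intro C hC
    have := congrArg (Int.cast : ℤ → R) (sum_neg_one_pow_fdim hC hD hbdd)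
    rw [Finset.sum_filter] at this
    push_cast at this
    exact this
  calc _ = ∑ F : ι → SignType, ∑ C : ι → SignType, (if IsChamber a b C then
          (if IsFace a b F ∧ faceLE F D ∧ tits F C = D then (-1 : R) ^ fdim a b F else 0) * x C
            else 0) := by
        refine Finset.sum_congr rfl fun F _ => ?_
        by_cases hF : IsFace a b F ∧ faceLE F D
        · rw [if_pos hF]
          refine Finset.sum_congr rfl fun C _ => ?_
          by_cases hC : IsChamber a b C <;> by_cases hT : tits F C = D <;>
            simp [hC, hT, hF.1, hF.2]
        · rw [if_neg hF, Finset.sum_eq_zero]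
          intro C _
          rw [if_neg (c := IsFace a b F ∧ faceLE F D ∧ tits F C = D) fun h => hF ⟨h.1, h.2.1⟩,
            zero_mul, ite_self]
    _ = ∑ C : ι → SignType, if C = D then x C else 0 := by
        rw [Finset.sum_comm]
        refine Finset.sum_congr rfl fun C _ => ?_
        by_cases hC : IsChamber a b C
        · simp only [if_pos hC]
          rw [← Finset.sum_mul, hswap C hC, ite_mul, one_mul, zero_mul]
        · simp only [if_neg hC, Finset.sum_const_zero]
          exact (if_neg fun h : C = D => hC (h ▸ hD)).symm
    _ = x D := by simp

end Varchenko
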